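/- Fix ϵ > 0, g > 1, κ > 0, and a closed interval I ⊂ ℝ of length 1. For every μ > 0 there exists ν > 0 such that for all A ∈ C²(I,ℝ) and B ∈ C¹(I,ℝ) satisfying ∫_I ((ϵ/2)|A''(x)|² + (1/2)|B'(x)|²) dx < κ and ∫_I P(A(x),B(x)) dx < ν, one has max_{x∈I} ( P(A(x),B(x)) + |A'(x)| ) < μ. -/

import Mathlib

open Set

/-- `P(a,b) = (1/4)(a²+b²−1)² + (1/2)(g−1)a²b²`. -/
noncomputable def Pfun (g a b : ℝ) : ℝ :=
  (1/4) * (a ^ 2 + b ^ 2 - 1) ^ 2 + (1/2) * (g - 1) * a ^ 2 * b ^ 2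

lemma aux_sub {t a b : ℝ} (ha : t ≤ a) (hb : b ≤ t + 1) : Icc a b ⊆ Icc t (t + 1) :=
  Icc_subset_Icc ha hb

/-- A point of small value on a subinterval. -/
lemma aux_pt {t a b : ℝ} {f : ℝ → ℝ} (hf : ContinuousOn f (Icc t (t + 1)))
    (h0 : ∀ x ∈ Icc t (t + 1), 0 ≤ f x) (ha : t ≤ a) (hab : a ≤ b) (hb : b ≤ t + 1) :
    ∃ z ∈ Icc a b, f z * (b - a) ≤ ∫ x in Icc t (t + 1), f x := by
  have hs := aux_sub ha hb
  obtain ⟨z, hz, hmin⟩ := isCompact_Icc.exists_isMinOn (nonempty_Icc.2 hab) (hf.mono hs)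
  refine ⟨z, hz, ?_⟩
  have hi : MeasureTheory.IntegrableOn f (Icc t (t + 1)) := hf.integrableOn_Icc
  have h1 : ∫ x in Icc a b, f z ≤ ∫ x in Icc a b, f x := by
    apply MeasureTheory.setIntegral_mono_on _ (hi.mono_set hs) measurableSet_Icc
    · intro x hx; exact hmin hx
    · exact continuousOn_const.integrableOn_Icc
  have h2 : ∫ x in Icc a b, f x ≤ ∫ x in Icc t (t + 1), f x := by
    apply MeasureTheory.setIntegral_mono_set hi _ hs.eventuallyLE
    exact (MeasureTheory.ae_restrict_iff' measurableSet_Icc).2 (Filter.Eventually.of_forall h0)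
  have h3 : ∫ x in Icc a b, f z = f z * (b - a) := by
    simp [hab, mul_comm]
  linarith

lemma aux_holder {t K : ℝ} {f f' : ℝ → ℝ}
    (hd : ∀ x ∈ Icc t (t + 1), HasDerivWithinAt f (f' x) (Icc t (t + 1)) x)
    (hc : ContinuousOn f' (Icc t (t + 1)))
    (hK : ∫ x in Icc t (t + 1), f' x ^ 2 ≤ K) :
    ∀ x ∈ Icc t (t + 1), ∀ y ∈ Icc t (t + 1), x ≤ y → (f y - f x) ^ 2 ≤ K * (y - x) := by
  intro x hx y hy hxy
  rcases hxy.eq_or_lt with rfl | hlt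
  · simp
  have hs := aux_sub hx.1 hy.2
  have hc' : ContinuousOn f' (Icc x y) := hc.mono hs
  have hcu : ContinuousOn f' (uIcc x y) := by rwa [uIcc_of_le hxy]
  have hft : ∫ z in x..y, f' z = f y - f x := by
    apply intervalIntegral.integral_eq_sub_of_hasDerivAt_of_le hxy
    · intro z hz; exact ((hd z (hs hz)).continuousWithinAt).mono hs
    · intro z hz
      exact (hd z (hs (Ioo_subset_Icc_self hz))).hasDerivAt
        (Icc_mem_nhds (lt_of_le_of_lt hx.1 hz.1) (lt_of_lt_of_le hz.2 hy.2))
    · exact hcu.intervalIntegrable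
  have h2 : ∫ z in x..y, f' z ^ 2 ≤ K := by
    rw [intervalIntegral.integral_of_le hxy, ← MeasureTheory.integral_Icc_eq_integral_Ioc]
    refine le_trans ?_ hK
    apply MeasureTheory.setIntegral_mono_set (hc.pow 2).integrableOn_Icc _ hs.eventuallyLE
    exact Filter.Eventually.of_forall fun z => sq_nonneg _
  set m := (f y - f x) / (y - x) with hm
  have hpos : 0 < y - x := by linarith
  have hmd : m * (y - x) = f y - f x := by rw [hm]; field_simp
  have h3 : 0 ≤ ∫ z in x..y, (f' z - m) ^ 2 :=
    intervalIntegral.integral_nonneg hxy fun z _ => sq_nonneg _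
  have h4 : ∫ z in x..y, (f' z - m) ^ 2
      = (∫ z in x..y, f' z ^ 2) - 2 * m * (f y - f x) + m ^ 2 * (y - x) := by
    have : (fun z => (f' z - m) ^ 2) = fun z => f' z ^ 2 - 2 * m * f' z + m ^ 2 := by
      funext z; ring
    rw [this, intervalIntegral.integral_add, intervalIntegral.integral_sub,
      intervalIntegral.integral_const_mul, hft, intervalIntegral.integral_const]
    · simp [mul_comm]
    · exact (hcu.pow 2).intervalIntegrable
    · exact (hcu.const_smul (2 * m)).intervalIntegrable
    · exact ((hcu.pow 2).sub (hcu.const_smul (2 * m))).intervalIntegrable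
    · exact intervalIntegrable_const
  rw [h4, ← hmd] at h3
  rw [← hmd]
  have h5 : m ^ 2 * (y - x) ≤ K := by nlinarith
  nlinarith

/-- symmetric version -/
lemma aux_holder' {t K : ℝ} {f f' : ℝ → ℝ}
    (hd : ∀ x ∈ Icc t (t + 1), HasDerivWithinAt f (f' x) (Icc t (t + 1)) x)
    (hc : ContinuousOn f' (Icc t (t + 1)))
    (hK : ∫ x in Icc t (t + 1), f' x ^ 2 ≤ K) :
    ∀ x ∈ Icc t (t + 1), ∀ y ∈ Icc t (t + 1), (f y - f x) ^ 2 ≤ K * |y - x| := by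
  intro x hx y hy
  rcases le_total x y with h | h
  · rw [abs_of_nonneg (by linarith)]; exact aux_holder hd hc hK x hx y hy h
  · rw [abs_of_nonpos (by linarith)]
    have := aux_holder hd hc hK y hy x hx h
    nlinarith

lemma aux_pigeon (c r : ℝ) (hr : 0 < r) :
    ∃ a ∈ Icc c (c + r), r / 6 ≤ |a| ∧ r / 6 ≤ |a - 1| ∧ r / 6 ≤ |a + 1| := by
  have key : ∀ p : ℝ, ∀ i j : ℝ, i + 1 ≤ j → |c + i * (r / 3) - p| < r / 6 →
      |c + j * (r / 3) - p| < r / 6 → False := by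
    intro p i j hij h1 h2
    rw [abs_lt] at h1 h2
    nlinarith
  by_contra hcon
  push Not at hcon
  have h : ∀ i : ℝ, 0 ≤ i → i ≤ 3 → |c + i * (r / 3) - 0| < r / 6 ∨
      |c + i * (r / 3) - 1| < r / 6 ∨ |c + i * (r / 3) - (-1)| < r / 6 := by
    intro i h0 h3
    by_contra hn
    push Not at hn
    obtain ⟨n1, n2, n3⟩ := hn
    rw [sub_zero] at n1
    rw [sub_neg_eq_add] at n3
    have := hcon (c + i * (r / 3)) ⟨by nlinarith, by nlinarith⟩ n1 n2
    linarith
  have a0 := h 0 (by norm_num) (by norm_num)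
  have a1 := h 1 (by norm_num) (by norm_num)
  have a2 := h 2 (by norm_num) (by norm_num)
  have a3 := h 3 (by norm_num) (by norm_num)
  have k := fun p => key p 0 1 (by norm_num)
  have k' := fun p => key p 0 2 (by norm_num)
  have k2 := fun p => key p 0 3 (by norm_num)
  have k3 := fun p => key p 1 2 (by norm_num)
  have k4 := fun p => key p 1 3 (by norm_num)
  have k5 := fun p => key p 2 3 (by norm_num)
  clear key h hcon
  rcases a0 with a0 | a0 | a0 <;> rcases a1 with a1 | a1 | a1 <;>
    first
    | exact k _ a0 a1
    | (rcases a2 with a2 | a2 | a2 <;>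
        first
        | exact k' _ a0 a2
        | exact k3 _ a1 a2
        | (rcases a3 with a3 | a3 | a3 <;>
            first
            | exact k2 _ a0 a3
            | exact k4 _ a1 a3
            | exact k5 _ a2 a3))

lemma aux_Pnn {g : ℝ} (hg : 1 < g) (a b : ℝ) : 0 ≤ Pfun g a b := by
  unfold Pfun
  have : 0 ≤ g - 1 := by linarith
  positivity

lemma aux_Pb {g : ℝ} (hg : 1 < g) (a b : ℝ) : a ^ 2 + b ^ 2 ≤ 2 + Pfun g a b := by
  unfold Pfun
  have : 0 ≤ (1/2) * (g - 1) * a ^ 2 * b ^ 2 := by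
    have : 0 ≤ g - 1 := by linarith
    positivity
  nlinarith [sq_nonneg (a ^ 2 + b ^ 2 - 3)]

lemma aux_alg {g M w η a b : ℝ} (hg : 1 < g) (hM : 0 < M) (hw : 0 < w)
    (h1 : η ≤ (w / (8 * M ^ 2)) ^ 2) (h2 : η ≤ w * (g - 1) / 8)
    (haM : |a| ≤ M) (hP : Pfun g a b < η) : |a ^ 2 * (a ^ 2 - 1)| < w := by
  unfold Pfun at hP
  have hg' : 0 < g - 1 := by linarith
  have hp2 : 0 ≤ (1/2) * (g - 1) * a ^ 2 * b ^ 2 := by positivity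
  have hs : a ^ 2 ≤ M ^ 2 := sq_le_sq' (by linarith [abs_le.1 haM]) (abs_le.1 haM).2
  have q1 : |a ^ 2 + b ^ 2 - 1| ≤ w / (4 * M ^ 2) := by
    apply abs_le_of_sq_le_sq _ (by positivity)
    have : w / (4 * M ^ 2) = 2 * (w / (8 * M ^ 2)) := by field_simp; norm_num
    rw [this]; nlinarith
  have q2 : a ^ 2 * b ^ 2 ≤ w / 4 := by
    have : (g - 1) * (a ^ 2 * b ^ 2) ≤ (g - 1) * (w / 4) := by
      nlinarith [sq_nonneg (a ^ 2 + b ^ 2 - 1)]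
    exact le_of_mul_le_mul_left this hg'
  have q3 : |a ^ 2 * (a ^ 2 + b ^ 2 - 1)| ≤ w / 4 := by
    rw [abs_mul, abs_of_nonneg (sq_nonneg a)]
    calc a ^ 2 * |a ^ 2 + b ^ 2 - 1| ≤ M ^ 2 * (w / (4 * M ^ 2)) := by gcongr
      _ = w / 4 := by field_simp
  have q4 : 0 ≤ a ^ 2 * b ^ 2 := by positivity
  rw [abs_le] at q3
  rw [abs_lt]
  constructor <;> nlinarith

lemma aux_unif (g M η : ℝ) (hη : 0 < η) : ∃ ρ > (0 : ℝ), ∀ a b a' b' : ℝ,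
    |a| ≤ M → |b| ≤ M → |a'| ≤ M → |b'| ≤ M → |a - a'| < ρ → |b - b'| < ρ →
    |Pfun g a b - Pfun g a' b'| < η := by
  have hc : Continuous fun p : ℝ × ℝ => Pfun g p.1 p.2 := by
    unfold Pfun; fun_prop
  have hu := (isCompact_Icc (a := -M) (b := M)).prod (isCompact_Icc (a := -M) (b := M))
    |>.uniformContinuousOn_of_continuous hc.continuousOn
  obtain ⟨ρ, hρ, h⟩ := Metric.uniformContinuousOn_iff.1 hu η hη
  refine ⟨ρ, hρ, fun a b a' b' h1 h2 h3 h4 h5 h6 => ?_⟩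
  have := h (a, b) ⟨abs_le.1 h1, abs_le.1 h2⟩ (a', b') ⟨abs_le.1 h3, abs_le.1 h4⟩
    (by rw [Prod.dist_eq]; exact max_lt h5 h6)
  exact this

lemma aux_int {t x δ : ℝ} (hx : x ∈ Icc t (t + 1)) (hδ : 0 < δ) (hδ2 : δ ≤ 1 / 2) :
    ∃ p, t ≤ p ∧ p + δ ≤ t + 1 ∧ ∀ z ∈ Icc p (p + δ), |z - x| ≤ δ := by
  obtain ⟨h1, h2⟩ := hx
  rcases le_total x (t + 1 / 2) with h | h
  · refine ⟨x, by linarith, by linarith, fun z hz => ?_⟩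
    rw [abs_le]; constructor <;> linarith [hz.1, hz.2]
  · refine ⟨x - δ, by linarith, by linarith, fun z hz => ?_⟩
    rw [abs_le]; constructor <;> linarith [hz.1, hz.2]

lemma aux_mvt {t p q : ℝ} {f f' : ℝ → ℝ}
    (hd : ∀ x ∈ Icc t (t + 1), HasDerivWithinAt f (f' x) (Icc t (t + 1)) x)
    (hp : t ≤ p) (hpq : p < q) (hq : q ≤ t + 1) :
    ∃ z ∈ Icc p q, f' z * (q - p) = f q - f p := by
  have hs := aux_sub hp hq
  obtain ⟨z, hz, h⟩ := exists_hasDerivAt_eq_slope f f' hpq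
    (fun z hz => ((hd z (hs hz)).continuousWithinAt).mono hs)
    (fun z hz => (hd z (hs (Ioo_subset_Icc_self hz))).hasDerivAt
        (Icc_mem_nhds (lt_of_le_of_lt hp hz.1) (lt_of_lt_of_le hz.2 hq)))
  refine ⟨z, Ioo_subset_Icc_self hz, ?_⟩
  rw [h]
  have : q - p ≠ 0 := by linarith
  field_simp

set_option maxHeartbeats 1000000 in
/-- Abstract version with explicit derivatives. -/
lemma aux_main (g KA KB : ℝ) (hg : 1 < g) (hKA : 0 < KA) (hKB : 0 < KB) (t μ : ℝ) (hμ : 0 < μ) :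
    ∃ ν > (0 : ℝ), ∀ A A' B : ℝ → ℝ,
      (∀ x ∈ Icc t (t + 1), HasDerivWithinAt A (A' x) (Icc t (t + 1)) x) →
      ContinuousOn B (Icc t (t + 1)) →
      (∀ x ∈ Icc t (t + 1), ∀ y ∈ Icc t (t + 1), (A' y - A' x) ^ 2 ≤ KA * |y - x|) →
      (∀ x ∈ Icc t (t + 1), ∀ y ∈ Icc t (t + 1), (B y - B x) ^ 2 ≤ KB * |y - x|) →
      (∫ x in Icc t (t + 1), Pfun g (A x) (B x)) < ν →
      ∀ x ∈ Icc t (t + 1), Pfun g (A x) (B x) + |A' x| < μ := by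
  obtain ⟨L, hL⟩ : ∃ L, L = 19 + KA := ⟨_, rfl⟩
  obtain ⟨M, hM⟩ : ∃ M, M = 6 + L + KB := ⟨_, rfl⟩
  have hLpos : 0 < L := by linarith
  have hMpos : 0 < M := by linarith
  obtain ⟨δ₁, hδ₁, hδ₁a, hδ₁b⟩ : ∃ δ > (0 : ℝ), δ ≤ 1 / 2 ∧ KA * δ ≤ (μ / 4) ^ 2 := by
    refine ⟨min (1 / 2) ((μ / 4) ^ 2 / KA), by positivity, min_le_left _ _, ?_⟩
    rw [mul_comm, ← le_div_iff₀ hKA]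
    exact min_le_right _ _
  obtain ⟨r, hr⟩ : ∃ r, r = μ * δ₁ / 4 := ⟨_, rfl⟩
  have hrpos : 0 < r := by rw [hr]; positivity
  obtain ⟨w, hw⟩ : ∃ w, w = (r / 6) ^ 4 := ⟨_, rfl⟩
  have hwpos : 0 < w := by rw [hw]; positivity
  have hg' : 0 < g - 1 := by linarith
  obtain ⟨η, hη, hη1, hη2, hη3⟩ : ∃ η > (0 : ℝ), η ≤ μ / 2 ∧ η ≤ (w / (8 * M ^ 2)) ^ 2 ∧
      η ≤ w * (g - 1) / 8 := by
    refine ⟨min (μ / 2) (min ((w / (8 * M ^ 2)) ^ 2) (w * (g - 1) / 8)), by positivity,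
      min_le_left _ _, (min_le_right _ _).trans (min_le_left _ _),
      (min_le_right _ _).trans (min_le_right _ _)⟩
  obtain ⟨ρ, hρ, hunif⟩ := aux_unif g M (η / 2) (by positivity)
  obtain ⟨δ, hδ, hδa, hδb, hδc⟩ : ∃ δ > (0 : ℝ), δ ≤ 1 / 2 ∧ KB * δ ≤ (ρ / 2) ^ 2 ∧
      L * δ ≤ ρ / 2 := by
    refine ⟨min (1 / 2) (min ((ρ / 2) ^ 2 / KB) (ρ / 2 / L)), by positivity, min_le_left _ _, ?_, ?_⟩
    · rw [mul_comm, ← le_div_iff₀ hKB]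
      exact (min_le_right _ _).trans (min_le_left _ _)
    · rw [mul_comm, ← le_div_iff₀ hLpos]
      exact (min_le_right _ _).trans (min_le_right _ _)
  refine ⟨min 1 (η * δ / 2), by positivity, ?_⟩
  intro A A' B hA hBc hA' hB hint
  have hint1 := lt_of_lt_of_le hint (min_le_left _ _)
  have hint2 := lt_of_lt_of_le hint (min_le_right _ _)
  have hAc : ContinuousOn A (Icc t (t + 1)) := fun x hx => (hA x hx).continuousWithinAt
  have hPc : ContinuousOn (fun x => Pfun g (A x) (B x)) (Icc t (t + 1)) := by
    unfold Pfun; fun_prop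
  have hP0 : ∀ x ∈ Icc t (t + 1), 0 ≤ Pfun g (A x) (B x) := fun x _ => aux_Pnn hg _ _
  have hdist : ∀ x ∈ Icc t (t + 1), ∀ y ∈ Icc t (t + 1), |y - x| ≤ 1 := by
    intro x hx y hy
    rw [abs_le]; constructor <;> linarith [hx.1, hx.2, hy.1, hy.2]
  -- points where A is bounded
  obtain ⟨x₁, hx₁, hP₁⟩ := aux_pt hPc hP0 (a := t) (b := t + 1 / 3) le_rfl (by linarith) (by linarith)
  obtain ⟨x₂, hx₂, hP₂⟩ := aux_pt hPc hP0 (a := t + 2 / 3) (b := t + 1)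
    (by linarith) (by linarith) le_rfl
  have hx₁I : x₁ ∈ Icc t (t + 1) := ⟨hx₁.1, by linarith [hx₁.2]⟩
  have hx₂I : x₂ ∈ Icc t (t + 1) := ⟨by linarith [hx₂.1], hx₂.2⟩
  have hb₁ := aux_Pb hg (A x₁) (B x₁)
  have hb₂ := aux_Pb hg (A x₂) (B x₂)
  have hA₁ : |A x₁| ≤ 3 := abs_le_of_sq_le_sq (by nlinarith [sq_nonneg (B x₁)]) (by norm_num)
  have hB₁ : |B x₁| ≤ 3 := abs_le_of_sq_le_sq (by nlinarith [sq_nonneg (A x₁)]) (by norm_num)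
  have hA₂ : |A x₂| ≤ 3 := abs_le_of_sq_le_sq (by nlinarith [sq_nonneg (B x₂)]) (by norm_num)
  obtain ⟨ξ, hξ, hξe⟩ := aux_mvt hA hx₁I.1 (q := x₂) (by linarith [hx₁.2, hx₂.1]) hx₂I.2
  have hξI := aux_sub hx₁I.1 hx₂I.2 hξ
  have hξb : |A' ξ| ≤ 18 := by
    have hd : 1 / 3 ≤ x₂ - x₁ := by linarith [hx₁.2, hx₂.1]
    have e : |A' ξ| * (x₂ - x₁) = |A x₂ - A x₁| := by
      rw [← hξe, abs_mul, abs_of_pos (show 0 < x₂ - x₁ by linarith)]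
    have e2 := abs_sub (A x₂) (A x₁)
    have e3 : |A' ξ| * (1 / 3) ≤ |A' ξ| * (x₂ - x₁) := by gcongr
    linarith
  have hAL : ∀ x ∈ Icc t (t + 1), |A' x| ≤ L := by
    intro x hx
    have h1 := hA' ξ hξI x hx
    have h2 := hdist ξ hξI x hx
    have h3 : |A' x - A' ξ| ≤ KA + 1 := by
      apply abs_le_of_sq_le_sq _ (by linarith)
      nlinarith
    rw [abs_le] at *
    constructor <;> linarith
  have hALip : ∀ x ∈ Icc t (t + 1), ∀ y ∈ Icc t (t + 1), |A y - A x| ≤ L * |y - x| := by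
    intro x hx y hy
    have := (convex_Icc t (t + 1)).norm_image_sub_le_of_norm_hasDerivWithin_le hA hAL hx hy
    simpa using this
  have hAM : ∀ x ∈ Icc t (t + 1), |A x| ≤ M := by
    intro x hx
    have h1 := hALip x₁ hx₁I x hx
    have h2 := hdist x₁ hx₁I x hx
    have h3 : |A x - A x₁| ≤ L := by nlinarith
    rw [abs_le] at *
    constructor <;> linarith
  have hBM : ∀ x ∈ Icc t (t + 1), |B x| ≤ M := by
    intro x hx
    have h1 := hB x₁ hx₁I x hx
    have h2 := hdist x₁ hx₁I x hx
    have h3 : |B x - B x₁| ≤ KB + 1 := by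
      apply abs_le_of_sq_le_sq _ (by linarith)
      nlinarith
    rw [abs_le] at *
    constructor <;> linarith
  -- P is uniformly small
  have hPs : ∀ x ∈ Icc t (t + 1), Pfun g (A x) (B x) < η := by
    intro x hx
    obtain ⟨p, hp1, hp2, hp3⟩ := aux_int hx hδ hδa
    obtain ⟨z, hz, hzP⟩ := aux_pt hPc hP0 hp1 (by linarith) hp2
    have hzI := aux_sub hp1 hp2 hz
    have hzx := hp3 z hz
    have h1 : |A z - A x| < ρ := by
      have := hALip x hx z hzI
      nlinarith
    have h2 : |B z - B x| < ρ := by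
      have h := hB x hx z hzI
      have : |B z - B x| ≤ ρ / 2 := by
        apply abs_le_of_sq_le_sq _ (by linarith)
        nlinarith
      linarith
    have h3 := hunif _ _ _ _ (hAM z hzI) (hBM z hzI) (hAM x hx) (hBM x hx) h1 h2
    have h4 : Pfun g (A z) (B z) < η / 2 := by
      by_contra hh
      push Not at hh
      have : η / 2 * δ ≤ Pfun g (A z) (B z) * (p + δ - p) := by
        rw [add_sub_cancel_left]; gcongr
      linarith
    linarith [(abs_lt.1 h3).1]
  intro x hx
  have hfin : |A' x| < μ / 2 := by
    by_contra hh
    push Not at hh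
    obtain ⟨p, hp1, hp2, hp3⟩ := aux_int hx hδ₁ hδ₁a
    obtain ⟨z, hz, hze⟩ := aux_mvt hA hp1 (q := p + δ₁) (by linarith) hp2
    have hs := aux_sub hp1 hp2
    have hzI := hs hz
    have h1 := hA' x hx z hzI
    have h2 := hp3 z hz
    have h3 : |A' z - A' x| ≤ μ / 4 := by
      apply abs_le_of_sq_le_sq _ (by linarith)
      nlinarith
    have h4 : μ / 4 ≤ |A' z| := by
      have := abs_sub_abs_le_abs_sub (A' x) (A' z)
      rw [abs_sub_comm] at this
      linarith
    have h5 : r ≤ |A (p + δ₁) - A p| := by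
      rw [← hze, abs_mul, add_sub_cancel_left, abs_of_pos hδ₁, hr]
      nlinarith
    obtain ⟨a, ha, ha1, ha2, ha3⟩ := aux_pigeon (min (A p) (A (p + δ₁))) r hrpos
    have hau : a ∈ uIcc (A p) (A (p + δ₁)) := by
      refine ⟨ha.1, ha.2.trans ?_⟩
      have := max_sub_min_eq_abs (A p) (A (p + δ₁))
      change _ ≤ max _ _
      linarith
    have hpd : uIcc p (p + δ₁) = Icc p (p + δ₁) := uIcc_of_le (by linarith)
    obtain ⟨y, hy, rfl⟩ := intermediate_value_uIcc (by rw [hpd]; exact hAc.mono hs) hau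
    rw [hpd] at hy
    have hyI := hs hy
    have h6 := aux_alg hg hMpos hwpos hη2 hη3 (hAM y hyI) (hPs y hyI)
    have h7 : w ≤ |A y ^ 2 * (A y ^ 2 - 1)| := by
      have : A y ^ 2 * (A y ^ 2 - 1) = A y * A y * (A y - 1) * (A y + 1) := by ring
      rw [this, abs_mul, abs_mul, abs_mul, hw]
      calc (r / 6) ^ 4 = (r / 6) * (r / 6) * (r / 6) * (r / 6) := by ring
        _ ≤ _ := by gcongr
    linarith
  linarith [hPs x hx]

/-- Fix `ϵ > 0`, `g > 1`, `κ > 0` and a closed interval `I` of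
length `1`. For every `μ > 0` there is `ν > 0` such that whenever
`∫_I ((ϵ/2)|A''|² + (1/2)|B'|²) < κ` and `∫_I P(A,B) < ν`, one has
`max_I (P(A,B) + |A'|) < μ`. -/
theorem small_energy_implies_small_P (ϵ g κ : ℝ) (hϵ : 0 < ϵ) (hg : 1 < g)
    (hκ : 0 < κ) (t : ℝ) :
    ∀ μ > (0 : ℝ), ∃ ν > (0 : ℝ), ∀ A B : ℝ → ℝ,
      ContDiffOn ℝ 2 A (Icc t (t + 1)) → ContDiffOn ℝ 1 B (Icc t (t + 1)) →
      (∫ x in Icc t (t + 1),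
          ((ϵ/2) * (iteratedDerivWithin 2 A (Icc t (t + 1)) x) ^ 2
            + (1/2) * (derivWithin B (Icc t (t + 1)) x) ^ 2)) < κ →
      (∫ x in Icc t (t + 1), Pfun g (A x) (B x)) < ν →
      ∀ x ∈ Icc t (t + 1),
        Pfun g (A x) (B x) + |derivWithin A (Icc t (t + 1)) x| < μ := by
  intro μ hμ
  obtain ⟨ν, hν, h⟩ := aux_main g (2 * κ / ϵ) (2 * κ) hg (by positivity) (by positivity) t μ hμ
  refine ⟨ν, hν, fun A B hA hB hE hP => ?_⟩
  have hu : UniqueDiffOn ℝ (Icc t (t + 1)) := uniqueDiffOn_Icc (by linarith)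
  have hA1 : ContDiffOn ℝ 1 (derivWithin A (Icc t (t + 1))) (Icc t (t + 1)) :=
    hA.derivWithin hu (by norm_num)
  have hit : ∀ x ∈ Icc t (t + 1), iteratedDerivWithin 2 A (Icc t (t + 1)) x
      = derivWithin (derivWithin A (Icc t (t + 1))) (Icc t (t + 1)) x := by
    intro x hx
    rw [iteratedDerivWithin_succ]
    exact derivWithin_congr (fun y hy => by rw [iteratedDerivWithin_one]) 
      (by rw [iteratedDerivWithin_one])
  have hA2c : ContinuousOn (derivWithin (derivWithin A (Icc t (t + 1))) (Icc t (t + 1)))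
      (Icc t (t + 1)) := hA1.continuousOn_derivWithin hu le_rfl
  have hB1c : ContinuousOn (derivWithin B (Icc t (t + 1))) (Icc t (t + 1)) :=
    hB.continuousOn_derivWithin hu le_rfl
  have hdA : ∀ x ∈ Icc t (t + 1),
      HasDerivWithinAt A (derivWithin A (Icc t (t + 1)) x) (Icc t (t + 1)) x :=
    fun x hx => ((hA.differentiableOn (by norm_num)) x hx).hasDerivWithinAt
  have hdA1 : ∀ x ∈ Icc t (t + 1), HasDerivWithinAt (derivWithin A (Icc t (t + 1)))
      (derivWithin (derivWithin A (Icc t (t + 1))) (Icc t (t + 1)) x) (Icc t (t + 1)) x :=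
    fun x hx => ((hA1.differentiableOn (by norm_num)) x hx).hasDerivWithinAt
  have hdB : ∀ x ∈ Icc t (t + 1),
      HasDerivWithinAt B (derivWithin B (Icc t (t + 1)) x) (Icc t (t + 1)) x :=
    fun x hx => ((hB.differentiableOn (by norm_num)) x hx).hasDerivWithinAt
  rw [MeasureTheory.setIntegral_congr_fun
    (g := fun x => (ϵ/2) * (derivWithin (derivWithin A (Icc t (t + 1))) (Icc t (t + 1)) x) ^ 2
            + (1/2) * (derivWithin B (Icc t (t + 1)) x) ^ 2) measurableSet_Icc
      (fun x hx => by simp only [hit x hx]),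
    MeasureTheory.integral_add, MeasureTheory.integral_const_mul,
    MeasureTheory.integral_const_mul] at hE
  rotate_left
  · exact ((hA2c.pow 2).const_smul (ϵ/2)).integrableOn_Icc
  · exact ((hB1c.pow 2).const_smul (1/2 : ℝ)).integrableOn_Icc
  have n1 : 0 ≤ ∫ x in Icc t (t + 1),
      (derivWithin (derivWithin A (Icc t (t + 1))) (Icc t (t + 1)) x) ^ 2 :=
    MeasureTheory.integral_nonneg fun x => sq_nonneg _
  have n2 : 0 ≤ ∫ x in Icc t (t + 1), (derivWithin B (Icc t (t + 1)) x) ^ 2 :=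
    MeasureTheory.integral_nonneg fun x => sq_nonneg _
  refine h A _ B hdA hB.continuousOn (aux_holder' hdA1 hA2c ?_) (aux_holder' hdB hB1c ?_) hP
  · rw [le_div_iff₀ hϵ]
    nlinarith
  · have : 0 ≤ ϵ / 2 * ∫ x in Icc t (t + 1),
      (derivWithin (derivWithin A (Icc t (t + 1))) (Icc t (t + 1)) x) ^ 2 := by positivity
    linarith
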